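/- No R₄-module of the form Coker η(a,b,c,ε) or Coker θ(a,b,c), with (a,b,c) a permutation of the cube roots of −1 and ε a primitive cube root of unity, is isomorphic to any module of the form Coker α(b',c',d',ε') or Coker β(b',c',d',ε') with (b')³ = (c')³ = (d')³ = −1 and ε' a primitive cube root of unity. -/

import Mathlib

open MvPolynomial Matrix TensorProduct

set_option maxHeartbeats 1000000
set_option synthInstance.maxHeartbeats 400000

noncomputable section

/-- The polynomial ring `S = K[Y₁,Y₂,Y₃,Y₄]`. -/
abbrev S (K : Type) [Field K] := MvPolynomial (Fin 4) K

/-- The variables `Y₁,…,Y₄` (indexed by `1,…,4`). -/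
def Yv (K : Type) [Field K] : ℕ → S K
  | 1 => X 0
  | 2 => X 1
  | 3 => X 2
  | 4 => X 3
  | _ => 0

/-- `f₄ = Y₁³+Y₂³+Y₃³+Y₄³`. -/
def f4 (K : Type) [Field K] : S K :=
  Yv K 1 ^ 3 + Yv K 2 ^ 3 + Yv K 3 ^ 3 + Yv K 4 ^ 3

/-- The hypersurface ring `R₄ = S/(f₄)`. -/
abbrev R4 (K : Type) [Field K] := S K ⧸ Ideal.span {f4 K}

/-- The canonical projection `S → R₄`. -/
abbrev proj (K : Type) [Field K] : S K →+* R4 K := Ideal.Quotient.mk (Ideal.span {f4 K})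

/-- The `R₄`-linear map `R₄ⁿ → R₄ⁿ` induced by an `n × n` matrix over `S`. -/
abbrev mbar (K : Type) [Field K] {n : ℕ} (M : Matrix (Fin n) (Fin n) (S K)) :
    (Fin n → R4 K) →ₗ[R4 K] (Fin n → R4 K) :=
  Matrix.mulVecLin (M.map ⇑(proj K))

/-- The cokernel of the `R₄`-linear map induced by a matrix over `S`. -/
abbrev coker (K : Type) [Field K] {n : ℕ} (M : Matrix (Fin n) (Fin n) (S K)) :=
  (Fin n → R4 K) ⧸ LinearMap.range (mbar K M)

/-- The matrix `φ_ij(a,b)`. -/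
def phiM (K : Type) [Field K] (a b : K) (i j s : ℕ) : Matrix (Fin 2) (Fin 2) (S K) :=
  !![Yv K 1 - C a * Yv K s, -(Yv K i ^ 2 + C b * Yv K i * Yv K j + C b ^ 2 * Yv K j ^ 2);
     Yv K i - C b * Yv K j, Yv K 1 ^ 2 + C a * Yv K 1 * Yv K s + C a ^ 2 * Yv K s ^ 2]

/-- The matrix `ψ_ij(a,b)`. -/
def psiM (K : Type) [Field K] (a b : K) (i j s : ℕ) : Matrix (Fin 2) (Fin 2) (S K) :=
  !![Yv K 1 ^ 2 + C a * Yv K 1 * Yv K s + C a ^ 2 * Yv K s ^ 2,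
       Yv K i ^ 2 + C b * Yv K i * Yv K j + C b ^ 2 * Yv K j ^ 2;
     -(Yv K i - C b * Yv K j), Yv K 1 - C a * Yv K s]

/-- The set `𝓛_i` of linear forms `Y_i - a Y_j` with `a³ = -1` and `i < j ≤ 4`. -/
def Lset (K : Type) [Field K] (i : ℕ) : Set (S K) :=
  {p | ∃ (a : K) (j : ℕ), a ^ 3 = -1 ∧ i < j ∧ j ≤ 4 ∧ p = Yv K i - C a * Yv K j}

/-- The matrix `α(b,c,d,ε)`, where `a = ε²bcd`. -/
def alphaM (K : Type) [Field K] (b c d ε : K) : Matrix (Fin 3) (Fin 3) (S K) :=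
  let a := ε ^ 2 * b * c * d
  !![0, Yv K 1 - C a * Yv K 4, Yv K 2 - C b * Yv K 3;
     Yv K 1 - C c * Yv K 2, -(C (b ^ 2) * Yv K 3) - C (a * b * c ^ 2 * ε ^ 2) * Yv K 4,
       C (b ^ 2 * c ^ 2) * Yv K 3 - C (a * b * c * ε ^ 2) * Yv K 4;
     Yv K 3 - C d * Yv K 4, C (c ^ 2) * Yv K 2 + C (b * c ^ 2) * Yv K 3 + C (a * c) * Yv K 4,
       -(Yv K 1) - C c * Yv K 2 - C a * Yv K 4]

/-- The matrix `β(b,c,d,ε)`, the transpose of `α(b,c,d,ε)`. -/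
def betaM (K : Type) [Field K] (b c d ε : K) : Matrix (Fin 3) (Fin 3) (S K) :=
  (alphaM K b c d ε).transpose

/-- The matrix `η(a,b,c,ε)`. -/
def etaM (K : Type) [Field K] (a b c ε : K) : Matrix (Fin 3) (Fin 3) (S K) :=
  !![0, Yv K 1 + Yv K 2, Yv K 3 - C a * Yv K 4;
     Yv K 1 + C ε * Yv K 2, -(Yv K 3) + C c * Yv K 4, 0;
     Yv K 3 - C b * Yv K 4, 0, -(Yv K 1) - C (ε ^ 2) * Yv K 2]

/-- The matrix `θ(a,b,c)` (denoted `ϑ(a,b,c)` in the paper). -/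
def thetaM (K : Type) [Field K] (a b c : K) : Matrix (Fin 3) (Fin 3) (S K) :=
  !![0, Yv K 1 + Yv K 3, Yv K 2 - C a * Yv K 4;
     Yv K 1 - C (a ^ 2 * b) * Yv K 3, -(Yv K 2) + C c * Yv K 4, 0;
     Yv K 2 - C b * Yv K 4, 0, -(Yv K 1) + C (a * b ^ 2) * Yv K 3]

/-- The matrix `D((a,b,c),(p,q,r))`. -/
def DM (K : Type) [Field K] (a b c p q r : K) : Matrix (Fin 3) (Fin 3) (S K) :=
  !![0, Yv K 1 - C a * Yv K 2, Yv K 3 - C p * Yv K 4;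
     Yv K 1 - C c * Yv K 2, -(Yv K 3) + C r * Yv K 4, 0;
     Yv K 3 - C q * Yv K 4, 0, -(Yv K 1) + C b * Yv K 2]

/-- `(a,b,c)` is a permutation (i.e. an enumeration) of the three cube roots of `-1` in `K`. -/
def cubePerm (K : Type) [Field K] (a b c : K) : Prop :=
  a ^ 3 = -1 ∧ b ^ 3 = -1 ∧ c ^ 3 = -1 ∧ a ≠ b ∧ a ≠ c ∧ b ≠ c


lemma exists_factor {R : Type} [CommRing R] (A : Matrix (Fin 3) (Fin 3) R)
    (g : (Fin 3 → R) →ₗ[R] (Fin 3 → R))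
    (h : ∀ x, g x ∈ LinearMap.range (Matrix.mulVecLin A)) :
    ∃ Q : Matrix (Fin 3) (Fin 3) R, LinearMap.toMatrix' g = A * Q := by
  choose q hq using h
  refine ⟨Matrix.of fun i j => q (Pi.single j 1) i, ?_⟩
  ext i j
  have := congrFun (hq (Pi.single j 1)) i
  have h2 : LinearMap.toMatrix' g i j = g (Pi.single j 1) i := by simp [LinearMap.toMatrix'_apply]
  rw [h2, ← this]
  simp [Matrix.mul_apply, Matrix.mulVec, dotProduct]

/-- Evaluation `R₄ → K[ε]` along `v`. -/
def rho (K : Type) [Field K] (v : Fin 4 → K) : R4 K →+* DualNumber K :=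
  Ideal.Quotient.lift (Ideal.span {f4 K})
    ((aeval (fun i => (TrivSqZeroExt.inr (v i) : DualNumber K))).toRingHom)
    (by
      intro x hx
      obtain ⟨y, rfl⟩ := Ideal.mem_span_singleton.1 hx
      simp [f4, Yv, pow_succ])

lemma fst_rho (K : Type) [Field K] (v : Fin 4 → K) (x : R4 K) :
    (rho K v x).fst = (rho K 0 x).fst := by
  obtain ⟨p, rfl⟩ := Ideal.Quotient.mk_surjective x
  have h : ∀ w : Fin 4 → K, (rho K w (Ideal.Quotient.mk _ p)).fst = eval 0 p := by
    intro w
    have : ((TrivSqZeroExt.fstHom K K K).comp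
        (aeval (fun i => (TrivSqZeroExt.inr (w i) : DualNumber K)))) = aeval (0 : Fin 4 → K) := by
      ext i
      simp
    have h2 := DFunLike.congr_fun this p
    have h3 : (aeval (0 : Fin 4 → K)) p = eval 0 p := by rw [← coe_aeval_eq_eval]; rfl
    rw [h3] at h2
    exact h2
  rw [h, h]

/-- All entries are linear forms. -/
def IsLin (K : Type) [Field K] (M : Matrix (Fin 3) (Fin 3) (S K)) : Prop :=
  ∀ v i j, aeval (fun i => (TrivSqZeroExt.inr (v i) : DualNumber K)) (M i j)
    = TrivSqZeroExt.inr (eval v (M i j))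

lemma matrix_eq (K : Type) [Field K] (M N : Matrix (Fin 3) (Fin 3) (S K))
    (hM : IsLin K M) (hN : IsLin K N)
    (e : coker K M ≃ₗ[R4 K] coker K N) :
    ∃ P Q : Matrix (Fin 3) (Fin 3) K, IsUnit P.det ∧
      ∀ v, P * M.map (eval v) = N.map (eval v) * Q := by
  obtain ⟨p, hp⟩ := Module.projective_lifting_property
    (LinearMap.range (mbar K N)).mkQ (e.toLinearMap ∘ₗ (LinearMap.range (mbar K M)).mkQ)
    (Submodule.mkQ_surjective _)
  obtain ⟨p', hp'⟩ := Module.projective_lifting_property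
    (LinearMap.range (mbar K M)).mkQ (e.symm.toLinearMap ∘ₗ (LinearMap.range (mbar K N)).mkQ)
    (Submodule.mkQ_surjective _)
  have hp1 : ∀ x, (LinearMap.range (mbar K N)).mkQ (p x)
      = e ((LinearMap.range (mbar K M)).mkQ x) := fun x => DFunLike.congr_fun hp x
  have hp2 : ∀ x, (LinearMap.range (mbar K M)).mkQ (p' x)
      = e.symm ((LinearMap.range (mbar K N)).mkQ x) := fun x => DFunLike.congr_fun hp' x
  obtain ⟨Q, hQ⟩ := exists_factor (N.map (proj K)) (p ∘ₗ mbar K M) (by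
    intro x
    rw [← Submodule.ker_mkQ (LinearMap.range (Matrix.mulVecLin (N.map (proj K)))),
      LinearMap.mem_ker]
    rw [LinearMap.comp_apply, hp1]
    have : (LinearMap.range (mbar K M)).mkQ (mbar K M x) = 0 := by
      rw [← LinearMap.mem_ker, Submodule.ker_mkQ]
      exact ⟨x, rfl⟩
    rw [this, map_zero])
  obtain ⟨W, hW⟩ := exists_factor (N.map (proj K)) (p ∘ₗ p' - LinearMap.id) (by
    intro x
    rw [← Submodule.ker_mkQ (LinearMap.range (Matrix.mulVecLin (N.map (proj K)))),
      LinearMap.mem_ker]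
    rw [LinearMap.sub_apply, map_sub, LinearMap.comp_apply, hp1, hp2]
    simp)
  rw [LinearMap.toMatrix'_comp, show LinearMap.toMatrix' (mbar K M) = M.map (proj K) from LinearMap.toMatrix'_toLin' _] at hQ
  rw [map_sub, LinearMap.toMatrix'_comp, LinearMap.toMatrix'_id] at hW
  set P := LinearMap.toMatrix' p
  set P' := LinearMap.toMatrix' p'
  have key : ∀ (L : Matrix (Fin 3) (Fin 3) (S K)), IsLin K L → ∀ v i j,
      rho K v (proj K (L i j)) = TrivSqZeroExt.inr (eval v (L i j)) := by
    intro L hL v i j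
    exact hL v i j
  refine ⟨P.map (fun x => (rho K 0 x).fst), Q.map (fun x => (rho K 0 x).fst), ?_, ?_⟩
  · have h1 : P.map (fun x => (rho K 0 x).fst) * P'.map (fun x => (rho K 0 x).fst) = 1 := by
      ext i j
      have h := congrArg (fun x => (rho K 0 x).fst) (congrFun (congrFun hW i) j)
      simp only [Matrix.sub_apply, Matrix.mul_apply, Fin.sum_univ_three, map_sub, map_add,
        map_mul, Matrix.map_apply, key N hN, TrivSqZeroExt.fst_sub, TrivSqZeroExt.fst_add,
        TrivSqZeroExt.fst_mul, TrivSqZeroExt.fst_inr] at h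
      simp only [Matrix.mul_apply, Fin.sum_univ_three, Matrix.map_apply]
      have h2 : (rho K 0 ((1 : Matrix (Fin 3) (Fin 3) (R4 K)) i j)).fst
          = (1 : Matrix (Fin 3) (Fin 3) K) i j := by
        rw [Matrix.one_apply, Matrix.one_apply]
        split_ifs <;> simp
      rw [h2] at h
      linear_combination h
    exact (Matrix.isUnit_iff_isUnit_det _).1 (IsUnit.of_mul_eq_one _ h1)
  · intro v
    ext i j
    have h := congrArg (fun x => (rho K v x).snd) (congrFun (congrFun hQ i) j)
    simp only [Matrix.mul_apply, Fin.sum_univ_three, map_add,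
      map_mul, Matrix.map_apply, key N hN, key M hM, TrivSqZeroExt.snd_add,
      TrivSqZeroExt.snd_mul, TrivSqZeroExt.fst_inr, TrivSqZeroExt.snd_inr, fst_rho K v] at h
    simp only [Matrix.mul_apply, Fin.sum_univ_three, Matrix.map_apply]
    simp at h
    linear_combination h

lemma adj_eq (K : Type) [Field K] (M N : Matrix (Fin 3) (Fin 3) (S K))
    (hM : IsLin K M) (hN : IsLin K N)
    (e : coker K M ≃ₗ[R4 K] coker K N) :
    ∃ A B : Matrix (Fin 3) (Fin 3) K,
      ∀ v, (M.map (eval v)).adjugate = A * (N.map (eval v)).adjugate * B := by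
  obtain ⟨P, Q, hP, h⟩ := matrix_eq K M N hM hN e
  refine ⟨Q.adjugate, P.det⁻¹ • P, fun v => ?_⟩
  have h1 := congrArg Matrix.adjugate (h v)
  rw [Matrix.adjugate_mul_distrib, Matrix.adjugate_mul_distrib] at h1
  rw [← h1, Matrix.mul_assoc, Matrix.mul_smul, Matrix.adjugate_mul, smul_smul,
    inv_mul_cancel₀ hP.ne_zero, one_smul, Matrix.mul_one]

/-- Coefficient of `Y_i Y_j` (`i ≠ j`) of a quadratic function. -/
def pol {K V : Type} [Field K] [AddCommGroup V] (g : (Fin 4 → K) → V) (i j : Fin 4) : V :=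
  g (Pi.single i 1 + Pi.single j 1) - g (Pi.single i 1) - g (Pi.single j 1)

/-- The functional attached to the Schur quadric of `α(b,c,d,ε)`. -/
def Lam {K V : Type} [Field K] [AddCommGroup V] [Module K V] (b c d ε : K)
    (g : (Fin 4 → K) → V) : V :=
  pol g 0 1 + (ε * b ^ 2) • pol g 0 2 + (ε ^ 2 * b ^ 2 * d ^ 2) • pol g 0 3
    + (ε ^ 2 * b ^ 2 * c ^ 2) • pol g 1 2 + (b ^ 2 * c ^ 2 * d ^ 2) • pol g 1 3
    - (ε * b * c ^ 2 * d ^ 2) • pol g 2 3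

lemma Lam_mul {K : Type} [Field K] (b c d ε : K) (A B : Matrix (Fin 3) (Fin 3) K)
    (g : (Fin 4 → K) → Matrix (Fin 3) (Fin 3) K) :
    Lam b c d ε (fun v => A * g v * B) = A * Lam b c d ε g * B := by
  simp only [Lam, pol, Matrix.mul_add, Matrix.mul_sub, Matrix.add_mul, Matrix.sub_mul,
    Matrix.mul_smul, Matrix.smul_mul]

lemma Lam_apply {K : Type} [Field K] (b c d ε : K)
    (g : (Fin 4 → K) → Matrix (Fin 3) (Fin 3) K) (i j : Fin 3) :
    (Lam b c d ε g) i j = Lam b c d ε (fun v => g v i j) := by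
  simp only [Lam, pol, Matrix.add_apply, Matrix.sub_apply, Matrix.smul_apply]

/-- Linear forms. -/
def LinF (K : Type) [Field K] (p : S K) : Prop :=
  ∀ v, aeval (fun i => (TrivSqZeroExt.inr (v i) : DualNumber K)) p
    = TrivSqZeroExt.inr (eval v p)

lemma LinF_zero (K : Type) [Field K] : LinF K 0 := by intro v; simp

lemma LinF_X (K : Type) [Field K] (i : Fin 4) : LinF K (X i) := by intro v; simp

lemma LinF_neg (K : Type) [Field K] (p : S K) (hp : LinF K p) : LinF K (-p) := by
  intro v; rw [map_neg, hp v, map_neg, TrivSqZeroExt.inr_neg]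

lemma LinF_add (K : Type) [Field K] (p q : S K) (hp : LinF K p) (hq : LinF K q) :
    LinF K (p + q) := by
  intro v; rw [map_add, hp v, hq v, map_add, TrivSqZeroExt.inr_add]

lemma LinF_sub (K : Type) [Field K] (p q : S K) (hp : LinF K p) (hq : LinF K q) :
    LinF K (p - q) := by
  intro v; rw [map_sub, hp v, hq v, map_sub, TrivSqZeroExt.inr_sub]

lemma LinF_C (K : Type) [Field K] (r : K) (p : S K) (hp : LinF K p) : LinF K (C r * p) := by
  intro v
  rw [← smul_eq_C_mul, map_smul, hp v, smul_eval, ← smul_eq_mul, TrivSqZeroExt.inr_smul]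

lemma LinF_Y (K : Type) [Field K] (n : ℕ) : LinF K (Yv K n) := by
  unfold Yv
  split
  · exact LinF_X K 0
  · exact LinF_X K 1
  · exact LinF_X K 2
  · exact LinF_X K 3
  · exact LinF_zero K

lemma isLin_of (K : Type) [Field K] (p q r s t u x y z : S K)
    (hp : LinF K p) (hq : LinF K q) (hr : LinF K r) (hs : LinF K s) (ht : LinF K t)
    (hu : LinF K u) (hx : LinF K x) (hy : LinF K y) (hz : LinF K z) :
    IsLin K !![p, q, r; s, t, u; x, y, z] := by
  intro v i j
  fin_cases i <;> fin_cases j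
  exacts [hp v, hq v, hr v, hs v, ht v, hu v, hx v, hy v, hz v]

lemma lin_alpha (K : Type) [Field K] (b c d ε : K) : IsLin K (alphaM K b c d ε) := by
  unfold alphaM
  apply isLin_of <;>
    repeat' first
      | with_reducible exact LinF_zero K
      | with_reducible exact LinF_Y K _
      | with_reducible refine LinF_neg K _ ?_
      | with_reducible refine LinF_add K _ _ ?_ ?_
      | with_reducible refine LinF_sub K _ _ ?_ ?_
      | with_reducible refine LinF_C K _ _ ?_

lemma lin_beta (K : Type) [Field K] (b c d ε : K) : IsLin K (betaM K b c d ε) :=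
  fun v i j => lin_alpha K b c d ε v j i

lemma lin_eta (K : Type) [Field K] (a b c ε : K) : IsLin K (etaM K a b c ε) := by
  unfold etaM
  apply isLin_of <;>
    repeat' first
      | with_reducible exact LinF_zero K
      | with_reducible exact LinF_Y K _
      | with_reducible refine LinF_neg K _ ?_
      | with_reducible refine LinF_add K _ _ ?_ ?_
      | with_reducible refine LinF_sub K _ _ ?_ ?_
      | with_reducible refine LinF_C K _ _ ?_

lemma lin_theta (K : Type) [Field K] (a b c : K) : IsLin K (thetaM K a b c) := by
  unfold thetaM
  apply isLin_of <;>
    repeat' first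
      | with_reducible exact LinF_zero K
      | with_reducible exact LinF_Y K _
      | with_reducible refine LinF_neg K _ ?_
      | with_reducible refine LinF_add K _ _ ?_ ?_
      | with_reducible refine LinF_sub K _ _ ?_ ?_
      | with_reducible refine LinF_C K _ _ ?_

lemma Lam_alpha (K : Type) [Field K] (b c d ε : K)
    (hb : b ^ 3 = -1) (hc : c ^ 3 = -1) (hd : d ^ 3 = -1) (he : ε ^ 2 + ε + 1 = 0) :
    Lam b c d ε (fun v => ((alphaM K b c d ε).map (eval v)).adjugate) = 0 := by
  ext i j
  rw [Lam_apply]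
  fin_cases i <;> fin_cases j <;>
    simp [Lam, pol, alphaM, Yv, Matrix.adjugate_fin_three] <;> grind

lemma Lam_beta (K : Type) [Field K] (b c d ε : K)
    (hb : b ^ 3 = -1) (hc : c ^ 3 = -1) (hd : d ^ 3 = -1) (he : ε ^ 2 + ε + 1 = 0) :
    Lam b c d ε (fun v => ((betaM K b c d ε).map (eval v)).adjugate) = 0 := by
  ext i j
  have h := congrFun (congrFun (Lam_alpha K b c d ε hb hc hd he) j) i
  rw [Lam_apply] at h ⊢
  have hv : ∀ v, ((betaM K b c d ε).map (eval v)).adjugate i j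
      = ((alphaM K b c d ε).map (eval v)).adjugate j i := by
    intro v
    change (((alphaM K b c d ε).map (eval v))ᵀ).adjugate i j = _
    rw [← Matrix.adjugate_transpose]
    rfl
  simp only [hv]
  exact h

lemma Lam_zero (K : Type) [Field K] (b c d ε : K) (M N : Matrix (Fin 3) (Fin 3) (S K))
    (hM : IsLin K M) (hN : IsLin K N)
    (h : Lam b c d ε (fun v => (N.map (eval v)).adjugate) = 0)
    (e : coker K M ≃ₗ[R4 K] coker K N) (i j : Fin 3) :
    Lam b c d ε (fun v => (M.map (eval v)).adjugate i j) = 0 := by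
  obtain ⟨A, B, hAB⟩ := adj_eq K M N hM hN e
  rw [← Lam_apply b c d ε (fun v => (M.map (eval v)).adjugate)]
  simp only [hAB]
  rw [Lam_mul, h]
  simp

lemma prim (K : Type) [Field K] (ε : K) (he : ε ^ 3 = 1) (hne : ε ≠ 1) :
    ε ^ 2 + ε + 1 = 0 := by
  have : (ε - 1) * (ε ^ 2 + ε + 1) = 0 := by linear_combination he
  exact (mul_eq_zero.1 this).resolve_left (sub_ne_zero.2 hne)

lemma eta_ne (K : Type) [Field K] (a b c ε b' c' d' ε' : K) (he : ε ^ 3 = 1) (hne : ε ≠ 1)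
    (h : ∀ i j, Lam b' c' d' ε' (fun v => ((etaM K a b c ε).map (eval v)).adjugate i j) = 0) :
    False := by
  have h1 := prim K ε he hne
  have h2 := h 2 2
  simp [Lam, pol, etaM, Yv, Matrix.adjugate_fin_three] at h2
  grind

lemma theta_ne (K : Type) [Field K] [CharZero K] (a b c b' c' d' ε' : K)
    (ha : a ^ 3 = -1) (hb : b ^ 3 = -1) (hb' : b' ^ 3 = -1) (he' : ε' ^ 3 = 1)
    (h : ∀ i j, Lam b' c' d' ε' (fun v => ((thetaM K a b c).map (eval v)).adjugate i j) = 0) :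
    False := by
  have h2 := h 2 2
  simp [Lam, pol, thetaM, Yv, Matrix.adjugate_fin_three] at h2
  have hb0 : b' ≠ 0 := by rintro rfl; simp at hb'
  have he0 : ε' ≠ 0 := by rintro rfl; simp at he'
  have h3 : a ^ 2 * b = 1 := by grind
  have h4 : (a ^ 2 * b) ^ 3 = -1 := by
    linear_combination (a ^ 3 * b ^ 3 - b ^ 3) * ha + hb
  rw [h3] at h4
  norm_num at h4

theorem stmt17 (K : Type) [Field K] [IsAlgClosed K] [CharZero K]
    (a b c ε b' c' d' ε' : K)
    (habc : cubePerm K a b c) (he : ε ^ 3 = 1) (hne : ε ≠ 1)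
    (hb' : b' ^ 3 = -1) (hc' : c' ^ 3 = -1) (hd' : d' ^ 3 = -1)
    (he' : ε' ^ 3 = 1) (hne' : ε' ≠ 1) :
    ¬ Nonempty (coker K (etaM K a b c ε) ≃ₗ[R4 K] coker K (alphaM K b' c' d' ε')) ∧
    ¬ Nonempty (coker K (etaM K a b c ε) ≃ₗ[R4 K] coker K (betaM K b' c' d' ε')) ∧
    ¬ Nonempty (coker K (thetaM K a b c) ≃ₗ[R4 K] coker K (alphaM K b' c' d' ε')) ∧
    ¬ Nonempty (coker K (thetaM K a b c) ≃ₗ[R4 K] coker K (betaM K b' c' d' ε')) := by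
  have p' := prim K ε' he' hne'
  obtain ⟨ha, hb, -⟩ := habc
  have hA := Lam_alpha K b' c' d' ε' hb' hc' hd' p'
  have hB := Lam_beta K b' c' d' ε' hb' hc' hd' p'
  have lA := lin_alpha K b' c' d' ε'
  have lB := lin_beta K b' c' d' ε'
  have lE := lin_eta K a b c ε
  have lT := lin_theta K a b c
  refine ⟨?_, ?_, ?_, ?_⟩
  · rintro ⟨e⟩
    exact eta_ne K a b c ε b' c' d' ε' he hne (Lam_zero K b' c' d' ε' _ _ lE lA hA e)
  · rintro ⟨e⟩
    exact eta_ne K a b c ε b' c' d' ε' he hne (Lam_zero K b' c' d' ε' _ _ lE lB hB e)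
  · rintro ⟨e⟩
    exact theta_ne K a b c b' c' d' ε' ha hb hb' he' (Lam_zero K b' c' d' ε' _ _ lT lA hA e)
  · rintro ⟨e⟩
    exact theta_ne K a b c b' c' d' ε' ha hb hb' he' (Lam_zero K b' c' d' ε' _ _ lT lB hB e)
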